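/- Let a ≤ s and b < s be positive integers and t ≥ 1. Then for every ε > 0 there is n_0 such that every K_{s,t}-free graph G on n ≥ n_0 vertices contains at most (α + ε) n^{a+b-ab/s} copies of K_{a,b}, where α = (1/(a!·(b!)^{1-a/s})) · binomial(t-1, b)^{a/s}. -/

import Mathlib

/-- A graph `G` contains a copy of `K_{s,t}`. -/
def ContainsKst {n : ℕ} (G : SimpleGraph (Fin n)) (s t : ℕ) : Prop :=
  ∃ A B : Finset (Fin n), Disjoint A B ∧ A.card = s ∧ B.card = t ∧
    ∀ a ∈ A, ∀ b ∈ B, G.Adj a b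

open Finset Filter Topology

/-- Power-mean inequality, for natural exponents. -/
lemma sum_pow_le_card_rpow_mul {ι : Type*} (F : Finset ι) (f : ι → ℝ) (hf : ∀ i ∈ F, 0 ≤ f i)
    {a s : ℕ} (ha : 0 < a) (has : a ≤ s) :
    ∑ i ∈ F, f i ^ a ≤
      (#F : ℝ) ^ (1 - (a : ℝ) / s) * (∑ i ∈ F, f i ^ s) ^ ((a : ℝ) / s) := by
  have ha' : (0 : ℝ) < a := by exact_mod_cast ha
  have hs' : (0 : ℝ) < s := by exact_mod_cast ha.trans_le has
  have hp : (1 : ℝ) ≤ (s : ℝ) / a := by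
    rw [le_div_iff₀ ha', one_mul]
    exact_mod_cast has
  have hsum : 0 ≤ ∑ i ∈ F, f i ^ a := sum_nonneg fun i hi => pow_nonneg (hf i hi) a
  have hsum' : 0 ≤ ∑ i ∈ F, f i ^ s := sum_nonneg fun i hi => pow_nonneg (hf i hi) s
  have key := Real.rpow_sum_le_const_mul_sum_rpow_of_nonneg F (f := fun i => f i ^ a) hp
    (fun i hi => pow_nonneg (hf i hi) a)
  have hpow : ∑ i ∈ F, (f i ^ a) ^ ((s : ℝ) / a) = ∑ i ∈ F, f i ^ s := by
    refine sum_congr rfl fun i hi => ?_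
    rw [← Real.rpow_natCast, ← Real.rpow_mul (hf i hi), mul_div_cancel₀ _ ha'.ne',
      Real.rpow_natCast]
  rw [hpow] at key
  have hroot := Real.rpow_le_rpow (Real.rpow_nonneg hsum _) key
    (by positivity : (0 : ℝ) ≤ (a : ℝ) / s)
  rw [← Real.rpow_mul hsum, Real.mul_rpow (by positivity) hsum',
    ← Real.rpow_mul (by positivity)] at hroot
  have h1 : (s : ℝ) / a * (a / s) = 1 := by field_simp
  have h2 : ((s : ℝ) / a - 1) * (a / s) = 1 - a / s := by rw [sub_mul, h1, one_mul]
  rwa [h1, h2, Real.rpow_one] at hroot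

/-- Shifting the base changes a power by a factor close to `1`, up to an additive constant. -/
lemma exists_add_pow_le (c a : ℕ) {δ : ℝ} (hδ : 0 < δ) :
    ∃ C : ℝ, 0 ≤ C ∧ ∀ y : ℕ, ((y : ℝ) + c) ^ a ≤ (1 + δ) * (y : ℝ) ^ a + C := by
  have hlim : Tendsto (fun y : ℕ => (1 + (c : ℝ) / y) ^ a) atTop (𝓝 1) := by
    simpa using ((tendsto_const_div_atTop_nhds_zero_nat (c : ℝ)).const_add 1).pow a
  obtain ⟨M, hM⟩ := eventually_atTop.1
    (hlim.eventually (eventually_le_nhds (show (1 : ℝ) < 1 + δ by linarith)))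
  refine ⟨((M : ℝ) + 1 + c) ^ a, by positivity, fun y => ?_⟩
  rcases le_total (M + 1) y with h | h
  · have hy : (0 : ℝ) < y := by exact_mod_cast (by omega : 0 < y)
    have hle := mul_le_mul_of_nonneg_right (hM y (by omega)) (pow_nonneg hy.le a)
    rw [← mul_pow, add_mul, one_mul, div_mul_cancel₀ _ hy.ne'] at hle
    have : (0 : ℝ) ≤ ((M : ℝ) + 1 + c) ^ a := by positivity
    linarith
  · have hy : (y : ℝ) ≤ M + 1 := by exact_mod_cast h
    have : ((y : ℝ) + c) ^ a ≤ ((M : ℝ) + 1 + c) ^ a := by gcongr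
    have : 0 ≤ (1 + δ) * (y : ℝ) ^ a := by positivity
    linarith

section CommonNeighbors

variable {n : ℕ} (G : SimpleGraph (Fin n))

open Classical in
/-- The set of vertices adjacent to every vertex of `B`. -/
noncomputable def commonNbrs (B : Finset (Fin n)) : Finset (Fin n) :=
  {x | ∀ y ∈ B, G.Adj x y}

lemma mem_commonNbrs {B : Finset (Fin n)} {x : Fin n} :
    x ∈ commonNbrs G B ↔ ∀ y ∈ B, G.Adj x y := by
  simp [commonNbrs]

lemma subset_commonNbrs_comm {A B : Finset (Fin n)} :
    A ⊆ commonNbrs G B ↔ B ⊆ commonNbrs G A := by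
  simp only [subset_iff, mem_commonNbrs]
  exact ⟨fun h y hy x hx => (h hx y hy).symm, fun h x hx y hy => (h hy x hx).symm⟩

/-- Copies of a complete bipartite graph can be counted from either side. -/
lemma sum_choose_card_commonNbrs (s b : ℕ) :
    ∑ B ∈ powersetCard b univ, (#(commonNbrs G B)).choose s =
      ∑ S ∈ powersetCard s univ, (#(commonNbrs G S)).choose b := by
  classical
  have h := sum_card_bipartiteAbove_eq_sum_card_bipartiteBelow
    (s := powersetCard b (univ : Finset (Fin n))) (t := powersetCard s (univ : Finset (Fin n)))
    (fun B S => S ⊆ commonNbrs G B)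
  convert h using 2 with B _ S _
  · rw [← card_powersetCard]
    congr 1
    ext S
    simp [bipartiteAbove, mem_powersetCard, and_comm]
  · rw [← card_powersetCard]
    congr 1
    ext B
    simp [bipartiteBelow, mem_powersetCard, and_comm, subset_commonNbrs_comm G (A := S)]

lemma card_commonNbrs_le_of_not_containsKst {s t : ℕ} (hG : ¬ ContainsKst G s t)
    {S : Finset (Fin n)} (hS : #S = s) : #(commonNbrs G S) ≤ t - 1 := by
  by_contra! hlt
  obtain ⟨T, hT, hTt⟩ := exists_subset_card_eq (show t ≤ #(commonNbrs G S) by omega)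
  refine hG ⟨S, T, ?_, hS, hTt, fun x hx y hy => ((mem_commonNbrs G).1 (hT hy) x hx).symm⟩
  exact disjoint_left.2 fun x hx hx' => G.irrefl ((mem_commonNbrs G).1 (hT hx') x hx)

lemma sum_choose_card_commonNbrs_le {s t : ℕ} (b : ℕ) (hG : ¬ ContainsKst G s t) :
    ∑ B ∈ powersetCard b univ, (#(commonNbrs G B)).choose s ≤
      n.choose s * (t - 1).choose b := by
  rw [sum_choose_card_commonNbrs]
  refine (sum_le_card_nsmul _ _ ((t - 1).choose b) fun S hS => ?_).trans_eq (by simp)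
  exact Nat.choose_le_choose b
    (card_commonNbrs_le_of_not_containsKst G hG (mem_powersetCard.1 hS).2)

lemma card_copies_le_sum_choose (a b : ℕ) :
    Nat.card {P : Finset (Finset (Fin n)) //
        ∃ A B : Finset (Fin n), P = {A, B} ∧ Disjoint A B ∧
          A.card = a ∧ B.card = b ∧ ∀ x ∈ A, ∀ y ∈ B, G.Adj x y} ≤
      ∑ B ∈ powersetCard b univ, (#(commonNbrs G B)).choose a := by
  classical
  let T : Finset (Σ _ : Finset (Fin n), Finset (Fin n)) :=
    (powersetCard b univ).sigma fun B => powersetCard a (commonNbrs G B)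
  have hT : #T = ∑ B ∈ powersetCard b univ, (#(commonNbrs G B)).choose a := by
    simp [T, card_sigma]
  rw [← hT, Nat.card_eq_fintype_card, Fintype.card_subtype]
  refine (card_le_card fun P hP => ?_).trans
    (card_image_le (s := T) (f := fun p => ({p.2, p.1} : Finset (Finset (Fin n)))))
  obtain ⟨A, B, rfl, -, hA, hB, hAB⟩ := (mem_filter.1 hP).2
  refine mem_image.2 ⟨⟨B, A⟩, ?_, rfl⟩
  simp only [T, mem_sigma, mem_powersetCard, subset_univ, true_and]
  exact ⟨hB, fun x hx => (mem_commonNbrs G).2 (hAB x hx), hA⟩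

/-- The excess of the codegrees over `s - 1` has small `s`-th moment in a `K_{s,t}`-free graph. -/
lemma sum_excess_pow_le {s t : ℕ} (b : ℕ) (hG : ¬ ContainsKst G s t) :
    ∑ B ∈ powersetCard b univ, ((#(commonNbrs G B) + 1 - s : ℕ) : ℝ) ^ s ≤
      (n : ℝ) ^ s * ((t - 1).choose b : ℝ) := by
  have h : ∑ B ∈ powersetCard b univ, (#(commonNbrs G B) + 1 - s) ^ s ≤
      n ^ s * (t - 1).choose b :=
    calc ∑ B ∈ powersetCard b univ, (#(commonNbrs G B) + 1 - s) ^ s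
        ≤ ∑ B ∈ powersetCard b univ, s.factorial * (#(commonNbrs G B)).choose s := by
          refine sum_le_sum fun B _ => ?_
          rw [← Nat.descFactorial_eq_factorial_mul_choose]
          exact Nat.pow_sub_le_descFactorial _ _
      _ ≤ s.factorial * (n.choose s * (t - 1).choose b) := by
          rw [← mul_sum]
          exact Nat.mul_le_mul_left _ (sum_choose_card_commonNbrs_le G b hG)
      _ ≤ n ^ s * (t - 1).choose b := by
          rw [← mul_assoc, ← Nat.descFactorial_eq_factorial_mul_choose]
          exact Nat.mul_le_mul_right _ (Nat.descFactorial_le_pow _ _)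
  exact_mod_cast h

lemma sum_excess_pow_le_rpow {s t a b : ℕ} (hn : 0 < n) (ha : 0 < a) (has : a ≤ s)
    (hG : ¬ ContainsKst G s t) :
    ∑ B ∈ powersetCard b univ, ((#(commonNbrs G B) + 1 - s : ℕ) : ℝ) ^ a ≤
      1 / (b.factorial : ℝ) ^ (1 - (a : ℝ) / s) * ((t - 1).choose b : ℝ) ^ ((a : ℝ) / s) *
        (n : ℝ) ^ ((a : ℝ) + b - a * b / s) := by
  have hn' : (0 : ℝ) < n := by exact_mod_cast hn
  have hs' : (0 : ℝ) < s := by exact_mod_cast ha.trans_le has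
  have hexp : 0 ≤ 1 - (a : ℝ) / s := by
    rw [sub_nonneg, div_le_one hs']
    exact_mod_cast has
  have hcard : (#(powersetCard b (univ : Finset (Fin n))) : ℝ) ≤
      (n : ℝ) ^ b / b.factorial := by
    simpa using Nat.choose_le_pow_div (α := ℝ) b n
  calc _ ≤ (#(powersetCard b (univ : Finset (Fin n))) : ℝ) ^ (1 - (a : ℝ) / s) *
        (∑ B ∈ powersetCard b univ, ((#(commonNbrs G B) + 1 - s : ℕ) : ℝ) ^ s) ^ ((a : ℝ) / s) :=
        sum_pow_le_card_rpow_mul _ _ (fun _ _ => Nat.cast_nonneg _) ha has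
    _ ≤ ((n : ℝ) ^ b / b.factorial) ^ (1 - (a : ℝ) / s) *
        ((n : ℝ) ^ s * ((t - 1).choose b : ℝ)) ^ ((a : ℝ) / s) := by
        have := sum_excess_pow_le G b hG
        gcongr
    _ = _ := by
        rw [Real.div_rpow (by positivity) (by positivity),
          Real.mul_rpow (by positivity) (by positivity), ← Real.rpow_natCast (n : ℝ) b,
          ← Real.rpow_natCast (n : ℝ) s, ← Real.rpow_mul hn'.le, ← Real.rpow_mul hn'.le]
        have hsplit : (a : ℝ) + b - a * b / s = b * (1 - a / s) + s * (a / s) := by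
          field_simp
          ring
        rw [hsplit, Real.rpow_add hn']
        ring

end CommonNeighbors

/-- Alon–Shikhelman bound (generalized hypotheses `a ≤ s`, `b < s`): a
`K_{s,t}`-free graph on `n ≥ n₀` vertices contains at most
`(α + ε) n^{a+b-ab/s}` copies of `K_{a,b}`, where
`α = (1/(a!·(b!)^{1-a/s})) · C(t-1, b)^{a/s}`. -/
theorem alon_shikhelman_Kab_bound
    (s t a b : ℕ) (hs : 0 < s) (ht : 1 ≤ t) (ha : 0 < a) (hb : 0 < b)
    (has : a ≤ s) (hbs : b < s) (ε : ℝ) (hε : 0 < ε) :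
    ∃ n₀ : ℕ, ∀ n ≥ n₀, ∀ G : SimpleGraph (Fin n), ¬ ContainsKst G s t →
      (Nat.card {P : Finset (Finset (Fin n)) //
          ∃ A B : Finset (Fin n), P = {A, B} ∧ Disjoint A B ∧
            A.card = a ∧ B.card = b ∧ ∀ x ∈ A, ∀ y ∈ B, G.Adj x y} : ℝ)
        ≤ (1 / ((Nat.factorial a : ℝ) *
              (Nat.factorial b : ℝ) ^ (1 - (a : ℝ) / s)) *
            ((Nat.choose (t - 1) b : ℝ)) ^ ((a : ℝ) / s) + ε) *
          (n : ℝ) ^ ((a : ℝ) + b - a * b / s) := by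
  set L : ℝ := 1 / (b.factorial : ℝ) ^ (1 - (a : ℝ) / s) *
    ((t - 1).choose b : ℝ) ^ ((a : ℝ) / s) with hL
  have hL0 : 0 ≤ L := by positivity
  have hs' : (0 : ℝ) < s := by exact_mod_cast hs
  have ha' : (0 : ℝ) < a := by exact_mod_cast ha
  have hfa : (1 : ℝ) ≤ a.factorial := by exact_mod_cast a.factorial_pos
  obtain ⟨C, hC0, hC⟩ := exists_add_pow_le s a
    (show 0 < ε / (2 * (L + 1)) by positivity)
  have hgap : 0 < (a : ℝ) - a * b / s := by
    have hlt : (b : ℝ) / s < 1 := by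
      rw [div_lt_one hs']
      exact_mod_cast hbs
    rw [mul_div_assoc]
    nlinarith
  obtain ⟨N, hN⟩ := eventually_atTop.1
    (((tendsto_rpow_atTop hgap).comp tendsto_natCast_atTop_atTop).eventually_ge_atTop
      (C / (ε / 2)))
  refine ⟨N + 1, fun n hn G hG => ?_⟩
  have hn0 : 0 < n := by omega
  have hn' : (0 : ℝ) < n := by exact_mod_cast hn0
  set E : ℝ := (n : ℝ) ^ ((a : ℝ) + b - a * b / s) with hE
  have hE0 : 0 ≤ E := by positivity
  have hlower : C * (n : ℝ) ^ b ≤ ε / 2 * E := by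
    have h := hN n (by omega)
    rw [Function.comp_apply, div_le_iff₀ (by positivity), mul_comm] at h
    calc C * (n : ℝ) ^ b
        ≤ ε / 2 * (n : ℝ) ^ ((a : ℝ) - a * b / s) * (n : ℝ) ^ b := by gcongr
      _ = ε / 2 * E := by
        rw [mul_assoc, ← Real.rpow_natCast (n : ℝ) b, ← Real.rpow_add hn', hE]
        congr 2
        ring
  have hδ : ε / (2 * (L + 1)) * L ≤ ε / 2 := by
    rw [div_mul_eq_mul_div, div_le_div_iff₀ (by positivity) (by positivity)]
    nlinarith
  have hsum : ∑ B ∈ powersetCard b univ, (#(commonNbrs G B) : ℝ) ^ a ≤ (L + ε) * E :=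
    calc ∑ B ∈ powersetCard b univ, (#(commonNbrs G B) : ℝ) ^ a
        ≤ ∑ B ∈ powersetCard b univ, ((1 + ε / (2 * (L + 1))) *
            ((#(commonNbrs G B) + 1 - s : ℕ) : ℝ) ^ a + C) := by
          refine sum_le_sum fun B _ => le_trans ?_ (hC _)
          have : (#(commonNbrs G B) : ℝ) ≤ ((#(commonNbrs G B) + 1 - s : ℕ) : ℝ) + s := by
            exact_mod_cast (by omega : #(commonNbrs G B) ≤ #(commonNbrs G B) + 1 - s + s)
          gcongr
      _ ≤ (1 + ε / (2 * (L + 1))) * (L * E) + C * (n : ℝ) ^ b := by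
          rw [sum_add_distrib, ← mul_sum, sum_const, card_powersetCard, card_univ,
            Fintype.card_fin, nsmul_eq_mul, mul_comm _ C]
          have h1 := sum_excess_pow_le_rpow G (b := b) hn0 ha has hG
          have h2 : (n.choose b : ℝ) ≤ (n : ℝ) ^ b := by exact_mod_cast Nat.choose_le_pow n b
          gcongr
      _ ≤ (L + ε) * E := by nlinarith [mul_le_mul_of_nonneg_right hδ hE0]
  have hcopies : (Nat.card {P : Finset (Finset (Fin n)) //
      ∃ A B : Finset (Fin n), P = {A, B} ∧ Disjoint A B ∧
        A.card = a ∧ B.card = b ∧ ∀ x ∈ A, ∀ y ∈ B, G.Adj x y} : ℝ) ≤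
      ∑ B ∈ powersetCard b univ, (#(commonNbrs G B) : ℝ) ^ a / a.factorial := by
    refine (Nat.cast_le.2 (card_copies_le_sum_choose G a b)).trans ?_
    rw [Nat.cast_sum]
    exact sum_le_sum fun B _ => Nat.choose_le_pow_div a _
  calc _ ≤ (L + ε) * E / a.factorial := by
        rw [← sum_div] at hcopies
        exact hcopies.trans (by gcongr)
    _ = (L / a.factorial + ε / a.factorial) * E := by ring
    _ ≤ (L / a.factorial + ε) * E := by
        gcongr
        exact div_le_self hε.le hfa
    _ = _ := by
        rw [hL]
        congr 2
        rw [one_div_mul_eq_div, one_div_mul_eq_div, div_div, mul_comm (a.factorial : ℝ)]
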